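/- Let S ∈ ℝ^{K×K} be irreducible with nonnegative entries and have support. Then there exist constants C > 0 and c > 0, depending only on S, such that for every τ ∈ (0, ρ(S)/2] and every entrywise positive solution (v,w) of the Dyson equation with parameter τ satisfying ⟨v⟩ = ⟨w⟩, one has c·τ^C ≤ v_i ≤ c^{−1}·τ^{−C} and c·τ^C ≤ w_i ≤ c^{−1}·τ^{−C} for every i ∈ {1,…,K}. -/

import Mathlib

open Matrix

/-- The normalized average `⟨x⟩ = (1/K) ∑ i, x i` of a vector. -/
noncomputable def avg {K : ℕ} (x : Fin K → ℝ) : ℝ := (∑ i, x i) / K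

/-- The Dyson equation (at `η = 0`) with parameter `τ > 0` for an entrywise positive pair
`(v, w)` with `Sw`, `Sᵗv` entrywise positive: `1/v = Sw + τ/(Sᵗv)`, `1/w = Sᵗv + τ/(Sw)`. -/
def DysonSol {K : ℕ} (S : Matrix (Fin K) (Fin K) ℝ) (τ : ℝ) (v w : Fin K → ℝ) : Prop :=
  (∀ i, 0 < v i) ∧ (∀ i, 0 < w i) ∧
  (∀ i, 0 < S.mulVec w i) ∧ (∀ i, 0 < Sᵀ.mulVec v i) ∧
  (∀ i, 1 / v i = S.mulVec w i + τ / Sᵀ.mulVec v i) ∧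
  (∀ i, 1 / w i = Sᵀ.mulVec v i + τ / S.mulVec w i)

set_option maxHeartbeats 1600000

lemma dy_conn {K : ℕ} (S : Matrix (Fin K) (Fin K) ℝ) (hS : ∀ i j, 0 ≤ S i j)
    (hirr : ∀ i j, ∃ m : ℕ, 1 ≤ m ∧ 0 < (S ^ m) i j)
    (I : Finset (Fin K)) (i k : Fin K) (hi : i ∈ I) (hk : k ∉ I) :
    ∃ a ∈ I, ∃ b, b ∉ I ∧ 0 < S a b := by
  by_contra hcon
  push Not at hcon
  have h0 : ∀ a ∈ I, ∀ b, b ∉ I → S a b = 0 :=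
    fun a ha b hb => le_antisymm (hcon a ha b hb) (hS a b)
  have hm : ∀ m : ℕ, ∀ a ∈ I, ∀ b, b ∉ I → (S ^ m) a b = 0 := by
    intro m
    induction m with
    | zero =>
      intro a ha b hb
      have : a ≠ b := fun h => hb (h ▸ ha)
      simp [Matrix.one_apply_ne this]
    | succ m ih =>
      intro a ha b hb
      rw [pow_succ, Matrix.mul_apply]
      apply Finset.sum_eq_zero
      intro j _
      by_cases hj : j ∈ I
      · rw [h0 j hj b hb, mul_zero]
      · rw [ih a ha j hj, zero_mul]
  obtain ⟨m, -, hpos⟩ := hirr i k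
  rw [hm m i hi k hk] at hpos
  exact lt_irrefl _ hpos

lemma dy_circ {K : ℕ} (F : Fin K → Fin K → ℝ) (h : ∀ i, ∑ k, F i k = ∑ k, F k i)
    (I : Finset (Fin K)) :
    ∑ i ∈ I, ∑ k ∈ Iᶜ, F i k = ∑ i ∈ I, ∑ k ∈ Iᶜ, F k i := by
  have h1 : ∑ i ∈ I, ∑ k, F i k = ∑ i ∈ I, ∑ k, F k i := Finset.sum_congr rfl fun i _ => h i
  have e1 : ∀ i, ∑ k, F i k = ∑ k ∈ I, F i k + ∑ k ∈ Iᶜ, F i k :=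
    fun i => (Finset.sum_add_sum_compl I _).symm
  have e2 : ∀ i, ∑ k, F k i = ∑ k ∈ I, F k i + ∑ k ∈ Iᶜ, F k i :=
    fun i => (Finset.sum_add_sum_compl I _).symm
  simp only [e1, e2, Finset.sum_add_distrib] at h1
  have h2 : ∑ i ∈ I, ∑ k ∈ I, F i k = ∑ i ∈ I, ∑ k ∈ I, F k i := Finset.sum_comm
  linarith

lemma dy_swap {K : ℕ} {S : Matrix (Fin K) (Fin K) ℝ} {τ : ℝ} {v w : Fin K → ℝ}
    (h : DysonSol S τ v w) : DysonSol Sᵀ τ w v := by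
  obtain ⟨h1, h2, h3, h4, h5, h6⟩ := h
  exact ⟨h2, h1, h4, by simpa using h3, by simpa using h6, by simpa using h5⟩

lemma dy_facts {K : ℕ} {S : Matrix (Fin K) (Fin K) ℝ} {τ : ℝ} {v w : Fin K → ℝ} (hτ : 0 < τ)
    (h : DysonSol S τ v w) (i : Fin K) :
    v i * (S.mulVec w i * Sᵀ.mulVec v i + τ) = Sᵀ.mulVec v i ∧
    w i * (S.mulVec w i * Sᵀ.mulVec v i + τ) = S.mulVec w i ∧
    v i * S.mulVec w i = w i * Sᵀ.mulVec v i ∧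
    τ * v i < Sᵀ.mulVec v i ∧ τ * (v i * w i) ≤ 1 := by
  obtain ⟨h1, h2, h3, h4, h5, h6⟩ := h
  have a1 := h1 i
  have a2 := h2 i
  have a3 := h3 i
  have a4 := h4 i
  have a5 := h5 i
  have a6 := h6 i
  generalize S.mulVec w i = a at *
  generalize Sᵀ.mulVec v i = b at *
  generalize v i = x at *
  generalize w i = y at *
  field_simp at a5 a6
  have e1 : x * (a * b + τ) = b := by linarith
  have e2 : y * (a * b + τ) = a := by linarith
  have e4 : τ * x < b := by nlinarith [mul_pos a1 (mul_pos a3 a4)]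
  have e3 : x * a = y * b := by
    rw [← e2, ← e1]
    rw [e1, e2]
    have : (a*b+τ) ≠ 0 := by positivity
    apply mul_right_cancel₀ this
    linear_combination a * e1 - b * e2
  refine ⟨e1, e2, e3, e4, ?_⟩
  have : y * b ≤ 1 := by
    have : y * b * x ≤ x := by
      have : y * b * x = x * a * x := by rw [e3]
      nlinarith [mul_pos a1 hτ]
    by_contra hh
    push Not at hh
    nlinarith
  nlinarith

lemma dy_bound {K : ℕ} {S : Matrix (Fin K) (Fin K) ℝ} (hS : ∀ i j, 0 ≤ S i j)
    {v : Fin K → ℝ} (hv : ∀ i, 0 < v i) (i : Fin K) :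
    Sᵀ.mulVec v i ≤ (∑ i, ∑ j, S i j) * ∑ j, v j := by
  simp only [Matrix.mulVec, dotProduct, Matrix.transpose_apply]
  rw [Finset.mul_sum]
  apply Finset.sum_le_sum
  intro j _
  apply mul_le_mul_of_nonneg_right _ (hv j).le
  calc S j i ≤ ∑ k, S j k := Finset.single_le_sum (f := fun k => S j k) (fun k _ => hS j k) (Finset.mem_univ i)
    _ ≤ _ := Finset.single_le_sum (f := fun k => ∑ l, S k l) (fun k _ => Finset.sum_nonneg fun l _ => hS k l) (Finset.mem_univ j)

lemma dy_step {K : ℕ} {S : Matrix (Fin K) (Fin K) ℝ} (hS : ∀ i j, 0 ≤ S i j)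
    {τ : ℝ} {v w : Fin K → ℝ} (hτ : 0 < τ) (h : DysonSol S τ v w)
    {σ s0 : ℝ} (hσ : σ = ∑ i, ∑ j, S i j) (hσ0 : 0 < σ) (hs0 : 0 < s0)
    (hmin : ∀ i j, 0 < S i j → s0 ≤ S i j) (hτσ : τ ≤ σ)
    (I : Finset (Fin K)) (hedge : ∃ a ∈ I, ∃ b, b ∉ I ∧ 0 < S a b)
    (u : ℝ) (hu : 0 < u) (hu1 : u ≤ 1) (hI : ∀ i ∈ I, u * ∑ j, v j ≤ v i) :
    ∃ k, k ∉ I ∧ τ * s0 / (4 * σ ^ 2) * u ^ 2 * ∑ j, v j ≤ v k := by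
  by_contra hcon
  push Not at hcon
  obtain ⟨a, ha, b, hb, hab⟩ := hedge
  have hbd := dy_bound hS h.1 b
  rw [← hσ] at hbd
  set V := ∑ j, v j with hV
  have hV0 : 0 < V := Finset.sum_pos (fun i _ => h.1 i) ⟨a, Finset.mem_univ a⟩
  set δ := τ * s0 / (4 * σ ^ 2) with hδ
  have hδ0 : 0 < δ := by positivity
  have hδe : δ * (4 * σ ^ 2) = τ * s0 := by rw [hδ]; field_simp
  have hcirc := dy_circ (fun i k => v i * S i k * w k) (by
    intro i
    have := (dy_facts hτ h i).2.2.1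
    simp only [Matrix.mulVec, dotProduct, Matrix.transpose_apply, Finset.mul_sum] at this
    calc _ = ∑ k, v i * (S i k * w k) := Finset.sum_congr rfl fun k _ => by ring
      _ = ∑ k, w i * (S k i * v k) := this
      _ = _ := Finset.sum_congr rfl fun k _ => by ring) I
  have hFnn : ∀ i k, 0 ≤ v i * S i k * w k := fun i k =>
    mul_nonneg (mul_nonneg (h.1 i).le (hS i k)) (h.2.1 k).le
  have hout : v a * S a b * w b ≤ ∑ i ∈ I, ∑ k ∈ Iᶜ, v i * S i k * w k := by
    calc _ ≤ ∑ k ∈ Iᶜ, v a * S a k * w k :=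
          Finset.single_le_sum (f := fun k => v a * S a k * w k) (fun k _ => hFnn a k) (by simpa using hb)
      _ ≤ _ := Finset.single_le_sum (f := fun i => ∑ k ∈ Iᶜ, v i * S i k * w k)
          (fun i _ => Finset.sum_nonneg fun k _ => hFnn i k) ha
  have hin : ∑ i ∈ I, ∑ k ∈ Iᶜ, v k * S k i * w i ≤ σ * (δ * u / τ) := by
    have h1 : ∑ i ∈ I, ∑ k ∈ Iᶜ, v k * S k i * w i ≤ ∑ i ∈ I, ∑ k ∈ Iᶜ, S k i * (δ * u / τ) := by
      apply Finset.sum_le_sum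
      intro i hi
      apply Finset.sum_le_sum
      intro k hk
      have hk' := (hcon k (by simpa using hk)).le
      have hi' := hI i hi
      have hvw := (dy_facts hτ h i).2.2.2.2
      have hw := h.2.1 i
      have : v k * w i ≤ δ * u / τ := by
        rw [le_div_iff₀ hτ]
        have e1 : v k * w i ≤ δ * u ^ 2 * V * w i := mul_le_mul_of_nonneg_right hk' hw.le
        have e2 : u * V * w i ≤ v i * w i := mul_le_mul_of_nonneg_right hi' hw.le
        have e3 : τ * (u * V * w i) ≤ 1 := by nlinarith
        have e4 : δ * u * (τ * (u * V * w i)) ≤ δ * u * 1 :=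
          mul_le_mul_of_nonneg_left e3 (by positivity)
        nlinarith
      nlinarith [mul_le_mul_of_nonneg_left this (hS k i)]
    refine h1.trans ?_
    simp only [← Finset.sum_mul]
    apply mul_le_mul_of_nonneg_right _ (by positivity)
    rw [Finset.sum_comm, hσ]
    calc ∑ k ∈ Iᶜ, ∑ i ∈ I, S k i ≤ ∑ k ∈ Iᶜ, ∑ i, S k i :=
          Finset.sum_le_sum fun k _ => Finset.sum_le_sum_of_subset_of_nonneg (Finset.subset_univ _)
            fun i _ _ => hS k i
      _ ≤ _ := Finset.sum_le_sum_of_subset_of_nonneg (Finset.subset_univ _)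
            fun k _ _ => Finset.sum_nonneg fun i _ => hS k i
  obtain ⟨f1, f2, f3, f4, f5⟩ := dy_facts hτ h b
  have hva : u * V ≤ v a := hI a ha
  have hbpos := h.2.2.2.1 b
  have hsab := hmin a b hab
  have hbl : s0 * (u * V) ≤ Sᵀ.mulVec v b := by
    calc s0 * (u * V) ≤ S a b * v a := mul_le_mul hsab hva (by positivity) (hS a b)
      _ ≤ _ := Finset.single_le_sum (f := fun k => S k b * v k)
        (fun k _ => mul_nonneg (hS k b) (h.1 k).le) (Finset.mem_univ a)
  have hvb := (hcon b hb).le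
  have hwb := h.2.1 b
  have hvb0 := h.1 b
  generalize S.mulVec w b = x at *
  generalize Sᵀ.mulVec v b = y at *
  -- y = v (x y + τ), v x = w y
  have k1 : y * (1 - w b * y) = τ * v b := by
    rw [← f3]; linear_combination -f1
  have k2 : τ * v b ≤ y / 2 := by
    have e1 : τ * v b ≤ τ * (δ * u ^ 2 * V) := mul_le_mul_of_nonneg_left hvb hτ.le
    have e2 : τ * δ ≤ s0 / 4 := by
      have : τ ^ 2 ≤ σ ^ 2 := by gcongr
      have h3 : τ * δ = s0 * (τ ^ 2 / (4 * σ ^ 2)) := by rw [hδ]; ring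
      have h4 : τ ^ 2 / (4 * σ ^ 2) ≤ 1 / 4 := by
        rw [div_le_iff₀ (by positivity)]; linarith
      rw [h3]
      nlinarith
    have e3 : τ * δ * (u ^ 2 * V) ≤ s0 / 4 * (u ^ 2 * V) :=
      mul_le_mul_of_nonneg_right e2 (by positivity)
    have e4 : u ^ 2 * V ≤ u * V := by nlinarith [mul_pos hu hV0]
    have e5 : s0 / 4 * (u ^ 2 * V) ≤ s0 / 4 * (u * V) :=
      mul_le_mul_of_nonneg_left e4 (by positivity)
    nlinarith
  have k3 : 1 / 2 ≤ w b * y := by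
    by_contra hh
    push Not at hh
    nlinarith
  have k4 : 1 / 2 ≤ w b * (σ * V) := k3.trans (mul_le_mul_of_nonneg_left hbd hwb.le)
  have k5 : u * V * s0 * w b ≤ v a * S a b * w b := by
    apply mul_le_mul_of_nonneg_right _ hwb.le
    exact mul_le_mul hva hsab hs0.le (h.1 a).le
  have k6 : u * V * s0 * w b ≤ σ * (δ * u / τ) := by
    refine k5.trans (hout.trans ?_)
    rw [hcirc]; exact hin
  have k7 : σ * (δ * u / τ) * (4 * σ) = s0 * u := by
    have : σ * (δ * u / τ) * (4 * σ) = δ * (4 * σ ^ 2) * u / τ := by ring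
    rw [this, hδe]; field_simp
  have k8 : u * V * s0 * w b * (4 * σ) ≤ s0 * u := by
    rw [← k7]; exact mul_le_mul_of_nonneg_right k6 (by positivity)
  have k9 : s0 * u * (4 * (1/2)) ≤ s0 * u * (4 * (w b * (σ * V))) := by gcongr
  have : 0 < s0 * u := by positivity
  nlinarith

lemma dy_all {K : ℕ} (hK : 1 ≤ K) {S : Matrix (Fin K) (Fin K) ℝ} (hS : ∀ i j, 0 ≤ S i j)
    {τ : ℝ} {v w : Fin K → ℝ} (hτ : 0 < τ) (h : DysonSol S τ v w)
    {σ s0 : ℝ} (hσ : σ = ∑ i, ∑ j, S i j) (hσ0 : 0 < σ) (hs0 : 0 < s0) (hsσ : s0 ≤ σ)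
    (hmin : ∀ i j, 0 < S i j → s0 ≤ S i j) (hτσ : τ ≤ σ)
    (hedge : ∀ I : Finset (Fin K), ∀ i ∈ I, ∀ k, k ∉ I → ∃ a ∈ I, ∃ b, b ∉ I ∧ 0 < S a b)
    (i : Fin K) :
    (s0 / (4 * σ ^ 2) / K * τ) ^ (2 ^ K - 1) * ∑ j, v j ≤ v i := by
  set V := ∑ j, v j with hV
  have hV0 : 0 < V := Finset.sum_pos (fun i _ => h.1 i) ⟨i, Finset.mem_univ i⟩
  have hKR : (1:ℝ) ≤ K := by exact_mod_cast hK
  set e := s0 / (4 * σ ^ 2) / K * τ with he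
  have he0 : 0 < e := by positivity
  have heδ : e * K = τ * s0 / (4 * σ ^ 2) := by rw [he]; field_simp
  have hδ1 : τ * s0 / (4 * σ ^ 2) ≤ 1 := by
    rw [div_le_one (by positivity)]; nlinarith
  have heK : e ≤ 1 / K := by
    rw [le_div_iff₀ (by positivity)]; linarith
  have heδ' : e ≤ τ * s0 / (4 * σ ^ 2) := by rw [← heδ]; nlinarith
  have he1 : e ≤ 1 := heδ'.trans hδ1
  have key : ∀ m : ℕ, m < K → ∃ I : Finset (Fin K), m + 1 ≤ I.card ∧
      ∀ i ∈ I, e ^ (2 ^ (m+1) - 1) * V ≤ v i := by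
    intro m
    induction m with
    | zero =>
      intro _
      obtain ⟨j, -, hj⟩ : ∃ j ∈ (Finset.univ : Finset (Fin K)), V / K ≤ v j := by
        apply Finset.exists_le_of_sum_le ⟨i, Finset.mem_univ i⟩
        simp only [Finset.sum_const, Finset.card_univ, Fintype.card_fin, nsmul_eq_mul]
        rw [mul_div_cancel₀]
        positivity
      refine ⟨{j}, by simp, ?_⟩
      intro a ha
      rw [Finset.mem_singleton] at ha
      subst ha
      refine le_trans ?_ hj
      have := mul_le_mul_of_nonneg_right heK hV0.le
      simp only [zero_add, pow_one, Nat.add_one_sub_one] 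
      norm_num
      linarith [show 1 / (K:ℝ) * V = V / K by ring]
    | succ m ih =>
      intro hm
      obtain ⟨I, hc, hI⟩ := ih (by omega)
      have hexp : 2 ^ (m + 1 + 1) - 1 = 1 + (2 ^ (m+1) - 1) * 2 := by
        have : 1 ≤ 2 ^ (m+1) := Nat.one_le_two_pow
        rw [pow_succ 2 (m+1)]
        omega
      have hmono : e ^ (2 ^ (m + 1 + 1) - 1) ≤ e ^ (2 ^ (m+1) - 1) :=
        pow_le_pow_of_le_one he0.le he1 (by omega)
      by_cases hall : ∃ k, k ∉ I
      · obtain ⟨k, hk⟩ := hall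
        obtain ⟨i0, hi0⟩ : I.Nonempty := Finset.card_pos.mp (by omega)
        obtain ⟨k', hk', hvk⟩ := dy_step hS hτ h hσ hσ0 hs0 hmin hτσ I (hedge I i0 hi0 k hk)
          (e ^ (2 ^ (m+1) - 1)) (by positivity) (pow_le_one₀ he0.le he1) hI
        refine ⟨insert k' I, by rw [Finset.card_insert_of_notMem hk']; omega, ?_⟩
        intro a ha
        rcases Finset.mem_insert.mp ha with rfl | ha
        · refine le_trans ?_ hvk
          apply mul_le_mul_of_nonneg_right _ hV0.le
          rw [hexp, pow_add, pow_one, pow_mul]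
          apply mul_le_mul_of_nonneg_right heδ' (by positivity)
        · exact (mul_le_mul_of_nonneg_right hmono hV0.le).trans (hI a ha)
      · push Not at hall
        refine ⟨I, ?_, fun a ha => (mul_le_mul_of_nonneg_right hmono hV0.le).trans (hI a ha)⟩
        rw [Finset.eq_univ_iff_forall.mpr hall]
        simp; omega
  obtain ⟨I, hc, hI⟩ := key (K - 1) (by omega)
  have hIu : I = Finset.univ := by
    apply Finset.eq_univ_of_card
    have := Finset.card_le_univ I
    simp at this ⊢
    omega
  have := hI i (hIu ▸ Finset.mem_univ i)
  rwa [Nat.sub_add_cancel hK] at this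

/-- Let `S` be irreducible nonnegative with support (positive diagonal up to
a permutation) and Perron–Frobenius eigenvalue `ρ` (characterized by a positive eigenvector).
Then there are constants `C, c > 0`, depending only on `S`, such that for every
`τ ∈ (0, ρ/2]` and every positive solution `(v, w)` of the Dyson equation with `⟨v⟩ = ⟨w⟩`,
one has `c τ^C ≤ v_i ≤ c⁻¹ τ^{−C}` and `c τ^C ≤ w_i ≤ c⁻¹ τ^{−C}` for all `i`. -/
theorem stmt_8 (K : ℕ) (hK : 1 ≤ K) (S : Matrix (Fin K) (Fin K) ℝ)
    (hS : ∀ i j, 0 ≤ S i j)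
    (hirr : ∀ i j, ∃ m : ℕ, 1 ≤ m ∧ 0 < (S ^ m) i j)
    (hsupp : ∃ π : Equiv.Perm (Fin K), ∀ i, 0 < S i (π i))
    (ρ : ℝ) (s : Fin K → ℝ) (hs : ∀ i, 0 < s i) (hseig : S.mulVec s = ρ • s) :
    ∃ C : ℝ, 0 < C ∧ ∃ c : ℝ, 0 < c ∧
      ∀ τ : ℝ, 0 < τ → τ ≤ ρ / 2 →
        ∀ v w : Fin K → ℝ, DysonSol S τ v w → avg v = avg w →
          ∀ i, (c * τ ^ C ≤ v i ∧ v i ≤ c⁻¹ * τ ^ (-C)) ∧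
               (c * τ ^ C ≤ w i ∧ w i ≤ c⁻¹ * τ ^ (-C)) := by
  have hKR : (1:ℝ) ≤ K := by exact_mod_cast hK
  obtain ⟨σ, hσ⟩ : ∃ σ, σ = ∑ i, ∑ j, S i j := ⟨_, rfl⟩
  obtain ⟨π, hπ⟩ := hsupp
  let i₀ : Fin K := ⟨0, hK⟩
  have hle : ∀ i j, S i j ≤ σ := by
    intro j i
    rw [hσ]
    calc S j i ≤ ∑ k, S j k := Finset.single_le_sum (f := fun k => S j k) (fun k _ => hS j k) (Finset.mem_univ i)
      _ ≤ _ := Finset.single_le_sum (f := fun k => ∑ l, S k l) (fun k _ => Finset.sum_nonneg fun l _ => hS k l) (Finset.mem_univ j)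
  have hσ0 : 0 < σ := (hπ i₀).trans_le (hle _ _)
  obtain ⟨s0, hs0, hsσ, hmin⟩ : ∃ s0 : ℝ, 0 < s0 ∧ s0 ≤ σ ∧ ∀ i j, 0 < S i j → s0 ≤ S i j := by
    obtain ⟨p, hp, hp2⟩ := Finset.exists_min_image
      (Finset.univ.filter fun p : Fin K × Fin K => 0 < S p.1 p.2) (fun p => S p.1 p.2)
      ⟨(i₀, π i₀), by simpa using hπ i₀⟩
    refine ⟨S p.1 p.2, by simpa using hp, hle _ _, fun i j hij => hp2 (i, j) (by simpa using hij)⟩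
  have hedge : ∀ I : Finset (Fin K), ∀ i ∈ I, ∀ k, k ∉ I → ∃ a ∈ I, ∃ b, b ∉ I ∧ 0 < S a b :=
    fun I i hi k hk => dy_conn S hS hirr I i k hi hk
  have hedgeT : ∀ I : Finset (Fin K), ∀ i ∈ I, ∀ k, k ∉ I → ∃ a ∈ I, ∃ b, b ∉ I ∧ 0 < Sᵀ a b := by
    intro I i hi k hk
    obtain ⟨a, ha, b, hb, hab⟩ := hedge Iᶜ k (by simpa using hk) i (by simpa using hi)
    exact ⟨b, by simpa using hb, a, by simpa using ha, hab⟩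
  have hσT : σ = ∑ i, ∑ j, Sᵀ i j := by
    rw [hσ]; exact Finset.sum_comm
  obtain ⟨N, hN⟩ : ∃ N, N = 2 ^ K - 1 := ⟨_, rfl⟩
  obtain ⟨g, hg⟩ : ∃ g, g = s0 / (4 * σ ^ 2) / K := ⟨_, rfl⟩
  have hg0 : 0 < g := by rw [hg]; positivity
  obtain ⟨q, hq⟩ : ∃ q, q = σ ^ 2 + σ + 1 := ⟨_, rfl⟩
  have hq0 : 0 < q := by rw [hq]; positivity
  obtain ⟨A, hA⟩ : ∃ A, A = g ^ N / q := ⟨_, rfl⟩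
  have hA0 : 0 < A := by rw [hA]; positivity
  refine ⟨((2 * (N + 1) : ℕ) : ℝ), by positivity, A ^ 2, by positivity, ?_⟩
  intro τ hτ hτρ v w h havg
  have hsum : ∑ j, v j = ∑ j, w j := by
    unfold avg at havg
    have hKne : (K:ℝ) ≠ 0 := by positivity
    field_simp at havg
    exact havg
  have hv := h.1
  have hw := h.2.1
  obtain ⟨V, hV⟩ : ∃ V, V = ∑ j, v j := ⟨_, rfl⟩
  have hV0 : 0 < V := by rw [hV]; exact Finset.sum_pos (fun i _ => hv i) ⟨i₀, Finset.mem_univ _⟩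
  have hbl : ∀ i, Sᵀ.mulVec v i ≤ σ * V := by
    intro i; rw [hσ, hV]; exact dy_bound hS hv i
  have hal : ∀ i, S.mulVec w i ≤ σ * V := by
    intro i
    have := dy_bound (S := Sᵀ) (fun i j => hS j i) hw i
    rwa [← hσT, ← hsum, ← hV, Matrix.transpose_transpose] at this
  have hτσ : τ ≤ σ := by
    have h1 : ∑ i, τ * v i ≤ ∑ i, Sᵀ.mulVec v i :=
      Finset.sum_le_sum fun i _ => (dy_facts hτ h i).2.2.2.1.le
    have h2 : ∑ i, Sᵀ.mulVec v i ≤ σ * V := by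
      simp only [Matrix.mulVec, dotProduct, Matrix.transpose_apply]
      rw [Finset.sum_comm, hV, Finset.mul_sum]
      apply Finset.sum_le_sum
      intro j _
      rw [← Finset.sum_mul]
      apply mul_le_mul_of_nonneg_right _ (hv j).le
      rw [hσ]
      exact Finset.single_le_sum (f := fun k => ∑ l, S k l) (fun k _ => Finset.sum_nonneg fun l _ => hS k l) (Finset.mem_univ j)
    rw [← Finset.mul_sum, ← hV] at h1
    exact le_of_mul_le_mul_right (h1.trans h2) hV0
  have hlv : ∀ i, (g * τ) ^ N * V ≤ v i := by
    intro i
    have := dy_all hK hS hτ h hσ hσ0 hs0 hsσ hmin hτσ hedge i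
    rwa [← hg, ← hN, ← hV] at this
  have hlw : ∀ i, (g * τ) ^ N * V ≤ w i := by
    intro i
    have := dy_all hK (S := Sᵀ) (fun i j => hS j i) hτ (dy_swap h) hσT hσ0 hs0 hsσ
      (fun i j => hmin j i) hτσ hedgeT i
    rwa [← hg, ← hN, ← hsum, ← hV] at this
  have hVsq : τ ≤ σ ^ 2 * V ^ 2 := by
    have h1 : ∑ i, s i * Sᵀ.mulVec v i = ∑ i, ρ * s i * v i := by
      have e1 : s ⬝ᵥ (Sᵀ.mulVec v) = (S.mulVec s) ⬝ᵥ v := by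
        rw [Matrix.dotProduct_mulVec, Matrix.vecMul_transpose]
      rw [hseig] at e1
      simpa [dotProduct] using e1
    obtain ⟨i, -, hi⟩ : ∃ i ∈ (Finset.univ : Finset (Fin K)), ρ * s i * v i ≤ s i * Sᵀ.mulVec v i :=
      Finset.exists_le_of_sum_le ⟨i₀, Finset.mem_univ _⟩ h1.symm.le
    have f1 := (dy_facts hτ h i).1
    have h2 : ρ ≤ S.mulVec w i * Sᵀ.mulVec v i + τ := by
      rw [← f1] at hi
      have hp : 0 < s i * v i := mul_pos (hs i) (hv i)
      have f1' := f1
      rw [f1] at hi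
      have : ρ * (s i * v i) ≤ (S.mulVec w i * Sᵀ.mulVec v i + τ) * (s i * v i) := by
        calc _ = ρ * s i * v i := by ring
          _ ≤ s i * Sᵀ.mulVec v i := hi
          _ = s i * (v i * (S.mulVec w i * Sᵀ.mulVec v i + τ)) := by rw [f1']
          _ = _ := by ring
      exact le_of_mul_le_mul_right this hp
    have h3 : S.mulVec w i * Sᵀ.mulVec v i ≤ (σ * V) * (σ * V) :=
      mul_le_mul (hal i) (hbl i) (h.2.2.2.1 i).le (by positivity)
    nlinarith
  have hq1 : 1 ≤ q := by rw [hq]; nlinarith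
  have hσq : σ ≤ q := by rw [hq]; nlinarith
  have hVt : τ / q ≤ V := by
    rw [div_le_iff₀ hq0]
    have h1 : τ ^ 2 ≤ (V * q) ^ 2 := by
      have e1 : τ ^ 2 ≤ σ * (σ ^ 2 * V ^ 2) := by
        rw [sq]; exact mul_le_mul hτσ hVsq hτ.le hσ0.le
      have e2 : σ * σ ^ 2 ≤ q ^ 2 := by
        have : σ ^ 2 ≤ q := by rw [hq]; nlinarith
        rw [sq q]; exact mul_le_mul hσq this (by positivity) hq0.le
      have e3 := mul_le_mul_of_nonneg_right e2 (sq_nonneg V)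
      nlinarith
    exact (pow_le_pow_iff_left₀ hτ.le (by positivity) two_ne_zero).mp h1
  have hgτ : g * τ ≤ 1 := by
    have : g * τ = s0 * τ / (4 * σ ^ 2 * K) := by rw [hg]; field_simp
    rw [this, div_le_one (by positivity)]
    have e1 : s0 * τ ≤ σ * σ := mul_le_mul hsσ hτσ hτ.le hσ0.le
    have e2 : σ ^ 2 * 1 ≤ σ ^ 2 * K := mul_le_mul_of_nonneg_left hKR (by positivity)
    nlinarith [sq_nonneg σ]
  obtain ⟨E, hE⟩ : ∃ E, E = (g * τ) ^ N := ⟨_, rfl⟩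
  have hE0 : 0 < E := by rw [hE]; positivity
  have hE1 : E ≤ 1 := by rw [hE]; exact pow_le_one₀ (by positivity) hgτ
  rw [← hE] at hlv hlw
  obtain ⟨t, ht⟩ : ∃ t, t = τ / q := ⟨_, rfl⟩
  have ht0 : 0 < t := by rw [ht]; positivity
  have ht1 : t ≤ 1 := by rw [ht, div_le_one hq0]; linarith
  have htτ : t ≤ τ := by rw [ht]; exact div_le_self hτ.le hq1
  rw [← ht] at hVt
  have hB : A ^ 2 * τ ^ (((2 * (N + 1) : ℕ) : ℝ)) = (E * t) ^ 2 := by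
    rw [Real.rpow_natCast, hE, ht, hA, pow_mul']
    rw [← mul_pow]
    congr 1
    rw [mul_pow]; ring
  have hB' : (A ^ 2)⁻¹ * τ ^ (-((2 * (N + 1) : ℕ) : ℝ)) = ((E * t) ^ 2)⁻¹ := by
    rw [Real.rpow_neg hτ.le, ← mul_inv, hB]
  rw [hB, hB']
  have hEt0 : 0 < E * t := by positivity
  have hEt1 : E * t ≤ 1 := by nlinarith
  have hlow : (E * t) ^ 2 ≤ E * V := by
    have : E * t ≤ E * V := mul_le_mul_of_nonneg_left hVt hE0.le
    nlinarith
  have hup : V ≤ ((E * t) ^ 2)⁻¹ := by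
    rw [← one_div, le_div_iff₀ (by positivity)]
    have f5 := (dy_facts hτ h i₀).2.2.2.2
    have e1 : (E * V) * (E * V) ≤ v i₀ * w i₀ :=
      mul_le_mul (hlv i₀) (hlw i₀) (by positivity) (hv i₀).le
    have e2 : τ * ((E * V) * (E * V)) ≤ 1 := (mul_le_mul_of_nonneg_left e1 hτ.le).trans f5
    have e3 : t * ((E * V) * (E * V)) ≤ τ * ((E * V) * (E * V)) :=
      mul_le_mul_of_nonneg_right htτ (by positivity)
    have e4 : t * (E ^ 2 * V * t) ≤ t * (E ^ 2 * V * V) := by gcongr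
    calc V * (E * t) ^ 2 = t * (E ^ 2 * V * t) := by ring
      _ ≤ t * (E ^ 2 * V * V) := e4
      _ = t * ((E * V) * (E * V)) := by ring
      _ ≤ 1 := e3.trans e2
  intro i
  have hvV : v i ≤ V := by
    rw [hV]; exact Finset.single_le_sum (fun k _ => (hv k).le) (Finset.mem_univ i)
  have hwV : w i ≤ V := by
    rw [hV, hsum]; exact Finset.single_le_sum (fun k _ => (hw k).le) (Finset.mem_univ i)
  exact ⟨⟨hlow.trans (hlv i), hvV.trans hup⟩, ⟨hlow.trans (hlw i), hwV.trans hup⟩⟩
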